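/- Let d ≥ 2, β > 0, δ > 0, and let Ψ be a translation invariant, spin-flip symmetric interaction on Ω = {1,-1}^{Z^d} which is zero on non-‖·‖_1-connected sets and satisfies ‖Ψ‖ < δ; write Φ = Φ^β + Ψ. Let Λ ⋐ Z^d be c-connected, ω ∈ Ω_Λ^+, and γ ∈ Γ(ω), and let ω_γ be the configuration obtained from ω by flipping all spins in int γ. Then exp(-H_{Φ,Λ}(ω)) ≤ e^{-2(β-δ)|γ|} · exp(-H_{Φ,Λ}(ω_γ)). -/

import Mathlib

open scoped BigOperators
open Real MeasureTheory Filter Topology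

namespace Ising

/-- The lattice `ℤ^d`. -/
abbrev V (d : ℕ) := Fin d → ℤ
/-- Spin configurations on `ℤ^d`; `true` encodes spin `+1`, `false` encodes spin `-1`. -/
abbrev Config (d : ℕ) := V d → Bool
/-- The ambient euclidean space `ℝ^d`. -/
abbrev Point (d : ℕ) := Fin d → ℝ

variable {d : ℕ}

noncomputable section

/-- The spin value (`±1`) of a boolean. -/
def spin (b : Bool) : ℝ := if b then 1 else -1

/-- An interaction assigns to each finite `Λ ⊆ ℤ^d` a function of configurations
(only the restriction to `Λ` is relevant; see `IsLocal`). -/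
abbrev Interaction (d : ℕ) := Finset (V d) → Config d → ℝ

/-- `Φ_Λ` depends only on the restriction of the configuration to `Λ`. -/
def IsLocal (Φ : Interaction d) : Prop :=
  ∀ (Λ : Finset (V d)) (ω ω' : Config d), (∀ x ∈ Λ, ω x = ω' x) → Φ Λ ω = Φ Λ ω'

/-- Translation of a configuration: `(τ^a ω)(x) = ω(x+a)`. -/
def translate (a : V d) (ω : Config d) : Config d := fun x => ω (x + a)

/-- Translation invariance of an interaction: `Φ_Λ(ω) = Φ_{Λ-a}(τ^a ω)`. -/
def TransInv (Φ : Interaction d) : Prop :=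
  ∀ (a : V d) (Λ : Finset (V d)) (ω : Config d),
    Φ (Λ.image (fun x => x - a)) (translate a ω) = Φ Λ ω

/-- Spin-flip symmetry: `Ψ_Λ(ω) = Ψ_Λ(-ω)`. -/
def SpinFlipSymm (Ψ : Interaction d) : Prop :=
  ∀ (Λ : Finset (V d)) (ω : Config d), Ψ Λ (fun x => !(ω x)) = Ψ Λ ω

/-- `sup_{ω ∈ Ω_Λ} |Φ_Λ(ω)|`. -/
def supNorm (Φ : Interaction d) (Λ : Finset (V d)) : ℝ := ⨆ ω : Config d, |Φ Λ ω|

/-- The summand of the norm `‖Φ‖`. -/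
def normTerm (Φ : Interaction d) (Λ : Finset (V d)) : ℝ :=
  if (0 : V d) ∈ Λ then supNorm Φ Λ else 0

/-- `‖Φ‖ = Σ_{0 ∈ Λ ⋐ ℤ^d} sup_{ω} |Φ_Λ(ω)|`. -/
def anorm (Φ : Interaction d) : ℝ := ∑' Λ : Finset (V d), normTerm Φ Λ

/-- Absolute summability of an interaction. -/
def AbsSummable (Φ : Interaction d) : Prop := Summable (normTerm Φ)

/-- `‖x-y‖_∞`. -/
def distInf (x y : V d) : ℕ := Finset.univ.sup fun i => (x i - y i).natAbs

/-- `‖x-y‖_1`. -/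
def dist1 (x y : V d) : ℕ := ∑ i, (x i - y i).natAbs

/-- `diam(Λ) = sup {‖x-y‖_∞ : x, y ∈ Λ}`. -/
def diam (Λ : Finset (V d)) : ℕ := Λ.sup fun x => Λ.sup fun y => distInf x y

/-- The summand of the `d`-th order decaying norm `|||Ψ|||`. -/
def dTerm (Ψ : Interaction d) (Λ : Finset (V d)) : ℝ :=
  if (0 : V d) ∈ Λ then ((diam Λ + 1 : ℕ) : ℝ) ^ d * supNorm Ψ Λ else 0

/-- `|||Ψ||| = Σ_{0 ∈ Λ ⋐ ℤ^d} (diam(Λ)+1)^d sup_{ω} |Ψ_Λ(ω)|`. -/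
def dnorm (Ψ : Interaction d) : ℝ := ∑' Λ : Finset (V d), dTerm Ψ Λ

/-- Summability of the `d`-th order decaying norm. -/
def DSummable (Ψ : Interaction d) : Prop := Summable (dTerm Ψ)

/-- The summand of the norm `|||Ψ|||'`. -/
def dTerm' (Ψ : Interaction d) (Λ : Finset (V d)) : ℝ :=
  if (0 : V d) ∈ Λ then (Λ.card : ℝ)⁻¹ * ((diam Λ + 1 : ℕ) : ℝ) ^ d * supNorm Ψ Λ else 0

/-- `|||Ψ|||' = Σ_{0 ∈ Λ ⋐ ℤ^d} |Λ|⁻¹ (diam(Λ)+1)^d sup_{ω} |Ψ_Λ(ω)|`. -/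
def dnorm' (Ψ : Interaction d) : ℝ := ∑' Λ : Finset (V d), dTerm' Ψ Λ

/-- Summability of the norm `|||·|||'`. -/
def DSummable' (Ψ : Interaction d) : Prop := Summable (dTerm' Ψ)

/-- The Hamiltonian `H_{Φ,Λ}(ω) = Σ_{Δ ⋐ ℤ^d, Δ ∩ Λ ≠ ∅} Φ_Δ(ω|_Δ)`. -/
def ham (Φ : Interaction d) (Λ : Finset (V d)) (ω : Config d) : ℝ :=
  ∑' Δ : Finset (V d), if (Δ ∩ Λ).Nonempty then Φ Δ ω else 0

/-- The configuration `ω_Λ ∨ η` agreeing with `f` on `Λ` and with `η` off `Λ`. -/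
def fill (Λ : Finset (V d)) (f : ↥Λ → Bool) (η : Config d) : Config d :=
  fun x => if h : x ∈ Λ then f ⟨x, h⟩ else η x

/-- The partition function `Z^η_{Φ,Λ}`. -/
def gibbsZ (Φ : Interaction d) (Λ : Finset (V d)) (η : Config d) : ℝ :=
  ∑ f : ↥Λ → Bool, Real.exp (-(ham Φ Λ (fill Λ f η)))

/-- The finite Gibbs state `μ^η_{Φ,Λ}({ω_Λ})`. -/
def finGibbs (Φ : Interaction d) (Λ : Finset (V d)) (η : Config d) (f : ↥Λ → Bool) : ℝ :=
  Real.exp (-(ham Φ Λ (fill Λ f η))) / gibbsZ Φ Λ η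

/-- The cylinder set `{ξ : ξ|_Λ = f}`. -/
def cyl (Λ : Finset (V d)) (f : ↥Λ → Bool) : Set (Config d) :=
  {ξ | ∀ (x : V d) (h : x ∈ Λ), ξ x = f ⟨x, h⟩}

/-- `σ` is a Gibbs state for `Φ` (DLR condition): for each finite `Λ` there is a Borel
probability measure on boundary conditions with respect to which `σ` of each cylinder
is the average of the finite Gibbs states. -/
def IsGibbs (Φ : Interaction d) (σ : Measure (Config d)) : Prop :=
  IsProbabilityMeasure σ ∧
  ∀ Λ : Finset (V d), ∃ ν : Measure (Config d), IsProbabilityMeasure ν ∧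
    ∀ f : ↥Λ → Bool, (σ (cyl Λ f)).toReal = ∫ η, finGibbs Φ Λ η f ∂ν

/-- Translation invariance of a measure: `τ^a_* σ = σ`. -/
def MeasTransInv (σ : Measure (Config d)) : Prop :=
  ∀ a : V d, σ.map (translate a) = σ

/-- The Ising interaction at inverse temperature `β`:
`Φ^β_Λ(ω) = -β ω(x) ω(y)` if `Λ = {x,y}` with `‖x-y‖₁ = 1`, and `0` otherwise. -/
def ising (β : ℝ) : Interaction d := fun Λ ω =>
  if Λ.card = 2 ∧ ∀ x ∈ Λ, ∀ y ∈ Λ, x ≠ y → dist1 x y = 1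
  then -β * ∏ x ∈ Λ, spin (ω x) else 0

/-- The sum of two interactions. -/
def Iadd (Φ Ψ : Interaction d) : Interaction d := fun Λ ω => Φ Λ ω + Ψ Λ ω

/-- `S` is connected for the adjacency given by `ρ`-distance `1`. -/
def ConnectedBy (ρ : V d → V d → ℕ) (S : Set (V d)) : Prop :=
  ∀ x ∈ S, ∀ y ∈ S, ∃ (n : ℕ) (p : ℕ → V d), p 0 = x ∧ p n = y ∧
    (∀ i ≤ n, p i ∈ S) ∧ ∀ i < n, ρ (p i) (p (i+1)) = 1

/-- `‖·‖₁`-connectedness. -/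
def Conn1 (S : Set (V d)) : Prop := ConnectedBy dist1 S

/-- `‖·‖_∞`-connectedness. -/
def ConnInf (S : Set (V d)) : Prop := ConnectedBy distInf S

/-- A finite set `Λ` is c-connected if both `Λ` and its complement are `‖·‖_∞`-connected. -/
def CConn (Λ : Finset (V d)) : Prop :=
  ConnInf (↑Λ : Set (V d)) ∧ ConnInf ((↑Λ : Set (V d))ᶜ)

/-- `Ψ` vanishes on sets that are not `‖·‖₁`-connected. -/
def ZeroOnNonConn (Ψ : Interaction d) : Prop :=
  ∀ Λ : Finset (V d), ¬ Conn1 (↑Λ : Set (V d)) → ∀ ω, Ψ Λ ω = 0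

/-- The closed unit cube `I_x` centered at `x ∈ ℤ^d`. -/
def cube (x : V d) : Set (Point d) := {y | ∀ i, |y i - (x i : ℝ)| ≤ 1/2}

/-- `M(S) = ⋃_{x ∈ S} I_x`. -/
def cubes (S : Set (V d)) : Set (Point d) := ⋃ x ∈ S, cube x

/-- A contour is the boundary `∂M(S)` of `M(S)` for a finite c-connected `S`. -/
def IsContour (γ : Set (Point d)) : Prop :=
  ∃ S : Finset (V d), CConn S ∧ γ = frontier (cubes ↑S)

/-- The set of sites with spin `-1`. -/
def minusSet (ω : Config d) : Set (V d) := {x | ω x = false}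

/-- `Γ(ω)`: the connected components of `∂M({x : ω(x) = -1})`. -/
def Gamma (ω : Config d) : Set (Set (Point d)) :=
  {γ | ∃ y ∈ frontier (cubes (minusSet ω)),
    γ = connectedComponentIn (frontier (cubes (minusSet ω))) y}

/-- The `(d-1)`-dimensional face of the unit cubes lying between `x` and `x + e_i`. -/
def face (x : V d) (i : Fin d) : Set (Point d) :=
  {y | y i = (x i : ℝ) + 1/2 ∧ ∀ j, j ≠ i → |y j - (x j : ℝ)| ≤ 1/2}

/-- A plaquette is a `(d-1)`-dimensional face of one of the cubes `I_x`. -/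
def IsPlaquette (P : Set (Point d)) : Prop := ∃ x i, P = face x i

/-- `|γ|`: the number of plaquettes contained in `γ`. -/
def csize (γ : Set (Point d)) : ℕ :=
  Nat.card {P : Set (Point d) // IsPlaquette P ∧ P ⊆ γ}

/-- The constant `+1` configuration. -/
def plusC : Config d := fun _ => true

/-- The constant `-1` configuration. -/
def minusC : Config d := fun _ => false

open scoped Classical in
/-- The finite-volume Gibbs probability (with boundary condition `η`) of an event
`A`: `μ^η_{Φ,Λ}({ω : ω ∨ η ∈ A})`. -/
def bcProb (Φ : Interaction d) (Λ : Finset (V d)) (η : Config d) (A : Set (Config d)) : ℝ :=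
  (∑ f : ↥Λ → Bool, if fill Λ f η ∈ A then Real.exp (-(ham Φ Λ (fill Λ f η))) else 0) /
    gibbsZ Φ Λ η

/-- `ω ∈ Ω_Λ^+`, i.e. `ω` is `+1` off `Λ`. -/
def plusOutside (Λ : Finset (V d)) (ω : Config d) : Prop := ∀ x, x ∉ Λ → ω x = true

/-- The configuration obtained by flipping all spins in `S`. -/
def flipOn (S : Finset (V d)) (ω : Config d) : Config d :=
  fun x => if x ∈ S then !(ω x) else ω x

/-- `|𝓔_Λ|`: the number of nearest-neighbour edges meeting `Λ`. -/
def edgeCount (Λ : Finset (V d)) : ℕ :=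
  Nat.card {e : Finset (V d) // (∃ x y, e = {x, y} ∧ dist1 x y = 1) ∧ (e ∩ Λ).Nonempty}

/-- `R` is a (nonempty) rectangle in `ℤ^d`. -/
def IsRect (R : Finset (V d)) : Prop := ∃ a b : V d, a ≤ b ∧ R = Finset.Icc a b

/-- `R(Λ)`: the minimal rectangle containing `Λ`. -/
def minRect (Λ : Finset (V d)) : Finset (V d) :=
  if h : Λ.Nonempty then
    Finset.Icc (fun i => Λ.inf' h fun x => x i) (fun i => Λ.sup' h fun x => x i)
  else ∅

open scoped Classical in
/-- The rectangle regrouping `Ψ̃` of `Ψ`: `Ψ̃_R(ω) = Σ_{Λ : R(Λ) = R} Ψ_Λ(ω|_Λ)` for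
rectangles `R`, and `Ψ̃_Λ = 0` for non-rectangles. -/
def regroup (Ψ : Interaction d) : Interaction d := fun R ω =>
  if IsRect R then ∑ Λ ∈ R.powerset, (if minRect Λ = R then Ψ Λ ω else 0) else 0


/-- Unit vector. -/
def ev (i : Fin d) : V d := Pi.single i 1

/-- Nearest-neighbour edge. -/
def pr (e : V d × Fin d) : Finset (V d) := {e.1, e.1 + ev e.2}

/-- Exactly one endpoint is in `A`. -/
def Bd (A : Set (V d)) (e : V d × Fin d) : Prop := ¬ (e.1 ∈ A ↔ e.1 + ev e.2 ∈ A)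

/-- The center of a face. -/
def ctr (x : V d) (i : Fin d) : Point d := fun j => (x j : ℝ) + if j = i then 1/2 else 0

lemma ev_same (i : Fin d) : ev i i = 1 := by simp [ev]
lemma ev_ne {i j : Fin d} (h : j ≠ i) : ev i j = 0 := by simp [ev, h]

lemma ctr_mem (x : V d) (i : Fin d) : ctr x i ∈ face x i := by
  refine ⟨by simp [ctr], fun j hj => by simp [ctr, hj]⟩

lemma int_close {a b : ℤ} (h : |(a : ℝ) - b| < 1) : a = b := by
  rw [abs_lt] at h
  have h1 : a - b < 1 := by exact_mod_cast h.2
  have h2 : -1 < a - b := by exact_mod_cast h.1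
  omega

lemma face_inj : Function.Injective (fun e : V d × Fin d => face e.1 e.2) := by
  rintro ⟨x, i⟩ ⟨y, j⟩ h
  have hm : ctr x i ∈ face y j := by
    have : face x i = face y j := h
    rw [← this]; exact ctr_mem x i
  obtain ⟨h1, h2⟩ := hm
  have hij : j = i := by
    by_contra hne
    simp only [ctr, hne, if_false] at h1
    have h3 : (2 * x j : ℝ) = 2 * y j + 1 := by linarith
    have : 2 * x j = 2 * y j + 1 := by exact_mod_cast h3
    omega
  subst hij
  have : x = y := by
    funext k
    by_cases hk : k = j
    · subst hk
      simp [ctr] at h1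
      exact h1
    · have := h2 k hk
      simp only [ctr, hk, if_false, add_zero] at this
      apply int_close
      linarith
  rw [this]

lemma face_sub_cube (x : V d) (i : Fin d) : face x i ⊆ cube x := by
  rintro y ⟨h1, h2⟩ j
  by_cases hj : j = i
  · subst hj; rw [h1]; norm_num
  · exact h2 j hj

lemma face_sub_cube' (x : V d) (i : Fin d) : face x i ⊆ cube (x + ev i) := by
  rintro y ⟨h1, h2⟩ j
  by_cases hj : j = i
  · subst hj; rw [h1, Pi.add_apply, ev_same, abs_le]; push_cast; constructor <;> linarith
  · rw [Pi.add_apply, ev_ne hj, add_zero]; exact h2 j hj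

lemma mem_frontier_of {A : Set (V d)} {x y : V d} (hx : x ∈ A) (hy : y ∉ A) {p : Point d}
    (hpx : p ∈ cube x) (hpy : p ∈ cube y) : p ∈ frontier (cubes A) := by
  refine ⟨subset_closure (Set.mem_biUnion hx hpx), fun hint => ?_⟩
  set f : ℝ → Point d := fun t => fun j => p j + t * ((y j : ℝ) - p j) with hf
  have hc : Continuous f := by fun_prop
  have h0 : f 0 = p := by funext j; simp [hf]
  have hn : f ⁻¹' (interior (cubes A)) ∈ 𝓝 (0 : ℝ) := by
    apply hc.continuousAt.preimage_mem_nhds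
    rw [h0]; exact isOpen_interior.mem_nhds hint
  obtain ⟨ε, hε, hb⟩ := Metric.mem_nhds_iff.1 hn
  set t := min (ε / 2) (1 / 2) with ht
  have htpos : 0 < t := by positivity
  have ht1 : t ≤ 1 / 2 := min_le_right _ _
  have htε : t < ε := lt_of_le_of_lt (min_le_left _ _) (by linarith)
  have hm : f t ∈ cubes A := interior_subset (hb (by
    rw [Metric.mem_ball, Real.dist_eq, sub_zero, abs_of_pos htpos]; exact htε))
  obtain ⟨z, hz, hzm⟩ := Set.mem_iUnion₂.1 hm
  apply hy
  have : z = y := by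
    funext j
    apply int_close
    have h1 := hzm j
    have h2 := hpy j
    simp only [hf] at h1
    rw [abs_le] at h1 h2
    rw [abs_lt]
    constructor <;> nlinarith
  rwa [← this]

lemma face_frontier {A : Set (V d)} (e : V d × Fin d) :
    face e.1 e.2 ⊆ frontier (cubes A) ↔ Bd A e := by
  obtain ⟨x, i⟩ := e
  constructor
  · intro h hiff
    have hc := h (ctr_mem x i)
    have hU : Metric.ball (ctr x i) (1/2) ∈ 𝓝 (ctr x i) := Metric.ball_mem_nhds _ (by norm_num)
    have hcoord : ∀ y ∈ Metric.ball (ctr x i) (1/2), ∀ j, |y j - ctr x i j| < 1/2 := by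
      intro y hy j
      have := lt_of_le_of_lt (dist_le_pi_dist y (ctr x i) j) (Metric.mem_ball.1 hy)
      rwa [Real.dist_eq] at this
    by_cases hx : x ∈ A
    · have hx' : x + ev i ∈ A := hiff.1 hx
      apply hc.2
      rw [mem_interior_iff_mem_nhds]
      refine Filter.mem_of_superset hU fun y hy => ?_
      by_cases hyi : y i ≤ x i + 1/2
      · refine Set.mem_biUnion hx fun j => ?_
        have := hcoord y hy j
        by_cases hj : j = i
        · subst hj
          simp only [ctr, if_true, abs_lt] at this
          rw [abs_le]; constructor <;> linarith
        · simp only [ctr, hj, if_false, add_zero] at this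
          exact this.le
      · refine Set.mem_biUnion hx' fun j => ?_
        have := hcoord y hy j
        by_cases hj : j = i
        · subst hj
          simp only [ctr, if_true, abs_lt] at this
          rw [Pi.add_apply, ev_same, abs_le]; push_cast; constructor <;> linarith
        · simp only [ctr, hj, if_false, add_zero] at this
          rw [Pi.add_apply, ev_ne hj, add_zero]; exact this.le
    · have hx' : x + ev i ∉ A := fun h' => hx (hiff.2 h')
      obtain ⟨y, hy, hyA⟩ := mem_closure_iff_nhds.1 hc.1 _ hU
      obtain ⟨z, hz, hzm⟩ := Set.mem_iUnion₂.1 hyA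
      have hother : ∀ j, j ≠ i → z j = x j := by
        intro j hj
        have h1 := hcoord y hy j
        have h2 := hzm j
        simp only [ctr, hj, if_false, add_zero] at h1
        apply int_close
        rw [abs_lt] at h1 ⊢; rw [abs_le] at h2
        constructor <;> linarith
      have h1 := hcoord y hy i
      have h2 := hzm i
      simp only [ctr, if_true] at h1
      rw [abs_lt] at h1; rw [abs_le] at h2
      have h3 : (z i : ℝ) < x i + 2 := by linarith
      have h4 : (x i : ℝ) - 1 < z i := by linarith
      have h3' : z i < x i + 2 := by exact_mod_cast h3
      have h4' : x i - 1 < z i := by exact_mod_cast h4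
      have : z i = x i ∨ z i = x i + 1 := by omega
      rcases this with h5 | h5
      · apply hx
        have : z = x := by
          funext j
          by_cases hj : j = i
          · rw [hj, h5]
          · exact hother j hj
        rwa [← this]
      · apply hx'
        have : z = x + ev i := by
          funext j
          by_cases hj : j = i
          · rw [hj, h5, Pi.add_apply, ev_same]
          · rw [Pi.add_apply, ev_ne hj, add_zero]; exact hother j hj
        rwa [← this]
  · intro h p hp
    by_cases hx : x ∈ A
    · have hx' : x + ev i ∉ A := fun h' => h ⟨fun _ => h', fun _ => hx⟩
      exact mem_frontier_of hx hx' (face_sub_cube x i hp) (face_sub_cube' x i hp)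
    · have hx' : x + ev i ∈ A := by
        by_contra h'
        exact h ⟨fun h'' => absurd h'' hx, fun h'' => absurd h'' h'⟩
      exact mem_frontier_of hx' hx (face_sub_cube' x i hp) (face_sub_cube x i hp)

open scoped Classical in
/-- Edges with both endpoints possibly near `S`. -/
def allE (S : Finset (V d)) : Finset (V d × Fin d) :=
  (S ∪ Finset.univ.biUnion fun i => S.image fun x => x - ev i) ×ˢ Finset.univ

lemma mem_allE {S : Finset (V d)} {e : V d × Fin d} (h : e.1 ∈ S ∨ e.1 + ev e.2 ∈ S) :
    e ∈ allE S := by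
  simp only [allE, Finset.mem_product, Finset.mem_union, Finset.mem_biUnion, Finset.mem_image,
    Finset.mem_univ, and_true, true_and]
  rcases h with h | h
  · exact Or.inl h
  · exact Or.inr ⟨e.2, _, h, by simp⟩

open scoped Classical in
/-- Boundary edges of `S`. -/
def bdE (S : Finset (V d)) : Finset (V d × Fin d) := (allE S).filter (Bd (↑S : Set (V d)))

lemma mem_bdE {S : Finset (V d)} {e : V d × Fin d} : e ∈ bdE S ↔ Bd (↑S : Set (V d)) e := by
  simp only [bdE, Finset.mem_filter, and_iff_right_iff_imp]
  intro h
  apply mem_allE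
  by_contra h'
  push Not at h'
  exact h ⟨fun h'' => absurd h'' h'.1, fun h'' => absurd h'' h'.2⟩

lemma csize_eq (S : Finset (V d)) : csize (frontier (cubes (↑S : Set (V d)))) = (bdE S).card := by
  have hcard : Nat.card ↥(↑(bdE S) : Set (V d × Fin d)) = (bdE S).card := by simp
  rw [csize, ← hcard]
  symm
  refine Nat.card_congr (Equiv.ofBijective
    (fun e : ↥(↑(bdE S) : Set (V d × Fin d)) => ⟨face e.1.1 e.1.2, ⟨_, _, rfl⟩,
      (face_frontier _).2 (mem_bdE.1 e.2)⟩) ⟨?_, ?_⟩)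
  · intro a b h
    exact Subtype.ext (face_inj (Subtype.ext_iff.1 h))
  · rintro ⟨P, ⟨x, i, rfl⟩, hP⟩
    exact ⟨⟨(x, i), mem_bdE.2 ((face_frontier (x, i)).1 hP)⟩, rfl⟩

lemma ev_ne_zero (i : Fin d) : ev i ≠ 0 := fun h => by
  have := congrFun h i
  rw [ev_same] at this
  simp at this

lemma ev_nonneg (i k : Fin d) : 0 ≤ ev i k := by
  by_cases h : k = i
  · rw [h, ev_same]; norm_num
  · rw [ev_ne h]

lemma pr_inj : Function.Injective (pr : V d × Fin d → Finset (V d)) := by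
  rintro ⟨x, i⟩ ⟨y, j⟩ h
  simp only [pr] at h
  have hx : x ∈ ({y, y + ev j} : Finset (V d)) := by rw [← h]; simp
  have hx' : x + ev i ∈ ({y, y + ev j} : Finset (V d)) := by rw [← h]; simp
  have hy : y ∈ ({x, x + ev i} : Finset (V d)) := by rw [h]; simp
  simp only [Finset.mem_insert, Finset.mem_singleton] at hx hx' hy
  have hxy : x = y := by
    rcases hx with hx | hx
    · exact hx
    · rcases hy with hy | hy
      · exact hy.symm
      · exfalso
        have h1 := congrFun hx i
        have h2 := congrFun hy i
        rw [Pi.add_apply] at h1 h2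
        rw [ev_same] at h2
        have := ev_nonneg j i
        omega
  subst hxy
  have hij : ev i = ev j := by
    rcases hx' with h' | h'
    · exact absurd (by simpa using h') (ev_ne_zero i)
    · simpa using h'
  have : i = j := by
    by_contra hne
    have := congrFun hij i
    rw [ev_same, ev_ne hne] at this
    omega
  rw [this]

lemma dist1_eq_one {x y : V d} (h : dist1 x y = 1) : ∃ i, y = x + ev i ∨ x = y + ev i := by
  have hne : ∃ i, (x i - y i).natAbs ≠ 0 := by
    by_contra hc
    push Not at hc
    simp [dist1, hc] at h
  obtain ⟨i, hi⟩ := hne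
  have hsplit := Finset.add_sum_erase Finset.univ (fun i => (x i - y i).natAbs) (Finset.mem_univ i)
  rw [show (∑ i, (x i - y i).natAbs) = 1 from h] at hsplit
  have hz : ∑ k ∈ Finset.univ.erase i, (x k - y k).natAbs = 0 := by omega
  have h1 : (x i - y i).natAbs = 1 := by omega
  have hk : ∀ k, k ≠ i → x k = y k := by
    intro k hk
    have := Finset.sum_eq_zero_iff.1 hz k (by simp [hk])
    omega
  refine ⟨i, ?_⟩
  have : y i = x i + 1 ∨ x i = y i + 1 := by omega
  rcases this with h2 | h2
  · left; funext k
    by_cases hki : k = i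
    · rw [hki, Pi.add_apply, ev_same, h2]
    · rw [Pi.add_apply, ev_ne hki, hk k hki, add_zero]
  · right; funext k
    by_cases hki : k = i
    · rw [hki, Pi.add_apply, ev_same, h2]
    · rw [Pi.add_apply, ev_ne hki, hk k hki, add_zero]

lemma dist1_ev (x : V d) (i : Fin d) : dist1 x (x + ev i) = 1 := by
  rw [dist1, Finset.sum_eq_single i]
  · simp [ev_same]
  · intro b _ hb
    simp [ev_ne hb]
  · simp

lemma dist1_comm (x y : V d) : dist1 x y = dist1 y x := by
  unfold dist1
  refine Finset.sum_congr rfl fun i _ => by omega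

lemma ne_add_ev (x : V d) (i : Fin d) : x ≠ x + ev i := fun h => ev_ne_zero i (by simpa using h)

lemma ising_pr (β : ℝ) (e : V d × Fin d) (ω : Config d) :
    ising β (pr e) ω = -β * (spin (ω e.1) * spin (ω (e.1 + ev e.2))) := by
  obtain ⟨x, i⟩ := e
  have hne := ne_add_ev x i
  rw [ising, if_pos]
  · simp only [pr]
    rw [Finset.prod_pair hne]
  · refine ⟨Finset.card_pair hne, ?_⟩
    intro a ha b hb hab
    simp only [pr, Finset.mem_insert, Finset.mem_singleton] at ha hb
    rcases ha with rfl | rfl <;> rcases hb with rfl | rfl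
    · exact absurd rfl hab
    · exact dist1_ev _ _
    · rw [dist1_comm]; exact dist1_ev _ _
    · exact absurd rfl hab

lemma ising_not_pr (β : ℝ) (Δ : Finset (V d)) (h : ∀ e, Δ ≠ pr e) (ω : Config d) :
    ising β Δ ω = 0 := by
  rw [ising, if_neg]
  rintro ⟨hc, hd⟩
  obtain ⟨x, y, hxy, rfl⟩ := Finset.card_eq_two.1 hc
  obtain ⟨i, hi | hi⟩ := dist1_eq_one (hd x (by simp) y (by simp) hxy)
  · exact h (x, i) (by simp [pr, hi])
  · exact h (y, i) (by rw [pr, Finset.pair_comm]; simp [hi])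

/-- Indicator-weighted sup norm. -/
def wt (Ψ : Interaction d) (x : V d) (Δ : Finset (V d)) : ℝ :=
  if x ∈ Δ then supNorm Ψ Δ else 0

lemma bdd_of_local {Ψ : Interaction d} (hloc : IsLocal Ψ) (Δ : Finset (V d)) :
    BddAbove (Set.range fun ω => |Ψ Δ ω|) := by
  apply Set.Finite.bddAbove
  refine (Set.finite_range fun f : ↥Δ → Bool => |Ψ Δ (fill Δ f plusC)|).subset ?_
  rintro _ ⟨ω, rfl⟩
  refine ⟨fun x => ω x, ?_⟩
  simp only
  rw [hloc Δ _ ω]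
  intro x hx
  simp [fill, hx]

lemma le_supNorm {Ψ : Interaction d} (hloc : IsLocal Ψ) (Δ : Finset (V d)) (ω : Config d) :
    |Ψ Δ ω| ≤ supNorm Ψ Δ := le_ciSup (bdd_of_local hloc Δ) ω

lemma supNorm_nonneg {Ψ : Interaction d} (Δ : Finset (V d)) : 0 ≤ supNorm Ψ Δ :=
  Real.iSup_nonneg fun _ => abs_nonneg _

lemma wt_nonneg {Ψ : Interaction d} (x : V d) (Δ : Finset (V d)) : 0 ≤ wt Ψ x Δ := by
  unfold wt; split_ifs
  · exact supNorm_nonneg _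
  · exact le_rfl

lemma supNorm_shift {Ψ : Interaction d} (hti : TransInv Ψ) (a : V d) (Δ : Finset (V d)) :
    supNorm Ψ (Δ.image fun x => x - a) = supNorm Ψ Δ := by
  unfold supNorm
  symm
  have hs : Function.Surjective (translate a : Config d → Config d) := by
    intro ω
    refine ⟨translate (-a) ω, ?_⟩
    funext x
    simp [translate]
  rw [← hs.iSup_comp (fun ω => |Ψ (Δ.image fun x => x - a) ω|)]
  exact iSup_congr fun ω => by rw [hti a Δ]

/-- Shift as an equivalence of finite sets. -/
def shiftE (a : V d) : Finset (V d) ≃ Finset (V d) where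
  toFun Δ := Δ.image fun x => x - a
  invFun Δ := Δ.image fun x => x + a
  left_inv Δ := by beta_reduce; rw [Finset.image_image]; simp [Function.comp_def]
  right_inv Δ := by beta_reduce; rw [Finset.image_image]; simp [Function.comp_def]

lemma wt_shift {Ψ : Interaction d} (hti : TransInv Ψ) (a : V d) :
    wt Ψ a = normTerm Ψ ∘ shiftE a := by
  funext Δ
  have h0 : (0 : V d) ∈ Δ.image (fun x => x - a) ↔ a ∈ Δ := by
    simp [sub_eq_zero]
  simp only [wt, normTerm, Function.comp, shiftE, Equiv.coe_fn_mk, h0, supNorm_shift hti]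

lemma wt_summable {Ψ : Interaction d} (hti : TransInv Ψ) (hsum : AbsSummable Ψ) (a : V d) :
    Summable (wt Ψ a) := by
  rw [wt_shift hti]
  exact (shiftE a).summable_iff.2 hsum

lemma wt_tsum {Ψ : Interaction d} (hti : TransInv Ψ) (a : V d) :
    ∑' Δ, wt Ψ a Δ = anorm Ψ := by
  rw [wt_shift hti]
  exact (shiftE a).tsum_eq (normTerm Ψ)

lemma ham_summable (β : ℝ) {Ψ : Interaction d} (hloc : IsLocal Ψ) (hti : TransInv Ψ)
    (hsum : AbsSummable Ψ) (Λ : Finset (V d)) (ω : Config d) :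
    Summable fun Δ : Finset (V d) =>
      if (Δ ∩ Λ).Nonempty then Iadd (ising β) Ψ Δ ω else 0 := by
  have h1 : Summable fun Δ : Finset (V d) => if (Δ ∩ Λ).Nonempty then ising β Δ ω else 0 := by
    apply summable_of_ne_finset_zero (s := (allE Λ).image pr)
    intro Δ hΔ
    by_cases hm : (Δ ∩ Λ).Nonempty
    · rw [if_pos hm]
      apply ising_not_pr
      rintro e rfl
      apply hΔ
      apply Finset.mem_image_of_mem
      apply mem_allE
      obtain ⟨z, hz⟩ := hm
      simp only [pr, Finset.mem_inter, Finset.mem_insert, Finset.mem_singleton] at hz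
      rcases hz with ⟨rfl | rfl, hz⟩
      · exact Or.inl hz
      · exact Or.inr hz
    · rw [if_neg hm]
  have h2 : Summable fun Δ : Finset (V d) => if (Δ ∩ Λ).Nonempty then Ψ Δ ω else 0 := by
    refine Summable.of_norm_bounded (g := fun Δ => ∑ x ∈ Λ, wt Ψ x Δ)
      (summable_sum fun x _ => wt_summable hti hsum x) ?_
    intro Δ
    by_cases hm : (Δ ∩ Λ).Nonempty
    · rw [if_pos hm, Real.norm_eq_abs]
      obtain ⟨z, hz⟩ := hm
      rw [Finset.mem_inter] at hz
      refine (le_supNorm hloc Δ ω).trans ?_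
      refine le_trans ?_ (Finset.single_le_sum (f := fun x => wt Ψ x Δ)
        (fun x _ => wt_nonneg x Δ) hz.2)
      simp [wt, hz.1]
    · rw [if_neg hm, norm_zero]
      exact Finset.sum_nonneg fun x _ => wt_nonneg x Δ
  refine (h1.add h2).congr fun Δ => ?_
  by_cases hm : (Δ ∩ Λ).Nonempty <;> simp [hm, Iadd]

lemma crossing {Δ S : Finset (V d)} (hc : Conn1 (↑Δ : Set (V d))) {x y : V d}
    (hx : x ∈ Δ) (hxS : x ∈ S) (hy : y ∈ Δ) (hyS : y ∉ S) :
    ∃ e ∈ bdE S, e.1 ∈ Δ := by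
  obtain ⟨n, p, h0, hn, hin, hst⟩ := hc x hx y hy
  have : ∃ k < n, p k ∈ S ∧ p (k+1) ∉ S := by
    by_contra hcon
    push Not at hcon
    have : ∀ k ≤ n, p k ∈ S := by
      intro k
      induction k with
      | zero => intro _; rw [h0]; exact hxS
      | succ k ih => intro hk; exact hcon k (by omega) (ih (by omega))
    exact hyS (hn ▸ this n le_rfl)
  obtain ⟨k, hk, h1, h2⟩ := this
  obtain ⟨i, hi | hi⟩ := dist1_eq_one (hst k hk)
  · refine ⟨(p k, i), mem_bdE.2 fun h => ?_, hin k hk.le⟩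
    simp only [← hi] at h
    exact h2 (h.1 h1)
  · refine ⟨(p (k+1), i), mem_bdE.2 fun h => ?_, hin (k+1) hk⟩
    simp only [← hi] at h
    exact h2 (h.2 h1)

lemma psi_diff {Ψ : Interaction d} (hloc : IsLocal Ψ) (hsf : SpinFlipSymm Ψ)
    (hzero : ZeroOnNonConn Ψ) (S Δ : Finset (V d)) (ω : Config d) :
    |Ψ Δ ω - Ψ Δ (flipOn S ω)| ≤ ∑ e ∈ bdE S, 2 * wt Ψ e.1 Δ := by
  have hnn : 0 ≤ ∑ e ∈ bdE S, 2 * wt Ψ e.1 Δ :=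
    Finset.sum_nonneg fun e _ => mul_nonneg (by norm_num) (wt_nonneg _ _)
  by_cases hc : Conn1 (↑Δ : Set (V d))
  swap
  · simpa [hzero Δ hc] using hnn
  by_cases h1 : ∀ x ∈ Δ, x ∈ S
  · have : Ψ Δ (flipOn S ω) = Ψ Δ ω := by
      rw [← hsf Δ ω]
      apply hloc
      intro x hx
      simp [flipOn, h1 x hx]
    simpa [this] using hnn
  by_cases h2 : ∀ x ∈ Δ, x ∉ S
  · have : Ψ Δ (flipOn S ω) = Ψ Δ ω := by
      apply hloc
      intro x hx
      simp [flipOn, h2 x hx]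
    simpa [this] using hnn
  push Not at h1 h2
  obtain ⟨y, hy, hyS⟩ := h1
  obtain ⟨x, hx, hxS⟩ := h2
  obtain ⟨e, he, heΔ⟩ := crossing hc hx hxS hy hyS
  have hb : 2 * wt Ψ e.1 Δ ≤ ∑ e ∈ bdE S, 2 * wt Ψ e.1 Δ :=
    Finset.single_le_sum (f := fun e : V d × Fin d => 2 * wt Ψ e.1 Δ)
      (fun e _ => mul_nonneg (by norm_num) (wt_nonneg _ _)) he
  have hw : wt Ψ e.1 Δ = supNorm Ψ Δ := by simp [wt, heΔ]
  have ha := le_supNorm hloc Δ ω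
  have hb' := le_supNorm hloc Δ (flipOn S ω)
  have := abs_sub (Ψ Δ ω) (Ψ Δ (flipOn S ω))
  rw [hw] at hb
  linarith

lemma ising_diff (β : ℝ) (Λ S Δ : Finset (V d)) (ω : Config d)
    (hω : plusOutside Λ ω) (hdis : ∀ e ∈ bdE S, ω e.1 ≠ ω (e.1 + ev e.2)) :
    (∑ e ∈ bdE S, if Δ = pr e then 2 * β else 0) =
      if (Δ ∩ Λ).Nonempty then ising β Δ ω - ising β Δ (flipOn S ω) else 0 := by
  by_cases hpr : ∃ e, Δ = pr e
  swap
  · push Not at hpr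
    simp [hpr, ising_not_pr β Δ hpr]
  obtain ⟨e, rfl⟩ := hpr
  simp only [pr_inj.eq_iff, Finset.sum_ite_eq, ising_pr]
  by_cases he : e ∈ bdE S
  · have hd := hdis e he
    have hm : (pr e ∩ Λ).Nonempty := by
      by_contra hm
      rw [Finset.not_nonempty_iff_eq_empty] at hm
      have hnot : ∀ z ∈ pr e, ω z = true := fun z hz => hω z fun hzΛ => by
        have : z ∈ pr e ∩ Λ := Finset.mem_inter.2 ⟨hz, hzΛ⟩
        rw [hm] at this
        simp at this
      exact hd ((hnot _ (by simp [pr])).trans (hnot _ (by simp [pr])).symm)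
    rw [if_pos he, if_pos hm]
    have hb := mem_bdE.1 he
    simp only [Bd, Finset.mem_coe] at hb
    by_cases h1 : e.1 ∈ S <;> by_cases h2 : e.1 + ev e.2 ∈ S <;>
      simp only [h1, h2, not_true, iff_self] at hb <;>
      cases h3 : ω e.1 <;> cases h4 : ω (e.1 + ev e.2) <;>
      simp [h3, h4] at hd <;> simp [flipOn, h1, h2, h3, h4, spin] <;> ring
  · rw [if_neg he]
    have hb : ¬ Bd (↑S : Set (V d)) e := fun h => he (mem_bdE.2 h)
    simp only [Bd, Finset.mem_coe, not_not] at hb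
    have : spin (flipOn S ω e.1) * spin (flipOn S ω (e.1 + ev e.2)) =
        spin (ω e.1) * spin (ω (e.1 + ev e.2)) := by
      by_cases h1 : e.1 ∈ S
      · have h2 := hb.1 h1
        cases h3 : ω e.1 <;> cases h4 : ω (e.1 + ev e.2) <;> simp [flipOn, h1, h2, h3, h4, spin]
      · have h2 : e.1 + ev e.2 ∉ S := fun h => h1 (hb.2 h)
        simp [flipOn, h1, h2]
    rw [this]; simp

/-- erasing a contour `γ ∈ Γ(ω)` (with interior `S`) by flipping the spins
in its interior decreases the energy:
`exp(-H_{Φ,Λ}(ω)) ≤ e^{-2(β-δ)|γ|} exp(-H_{Φ,Λ}(ω_γ))`. -/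
theorem flip_energy_estimate (d : ℕ) (hd : 2 ≤ d) (β δ : ℝ) (hβ : 0 < β) (hδ : 0 < δ)
    (Ψ : Interaction d) (hloc : IsLocal Ψ) (hti : TransInv Ψ) (hsf : SpinFlipSymm Ψ)
    (hzero : ZeroOnNonConn Ψ) (hsum : AbsSummable Ψ) (hn : anorm Ψ < δ)
    (Λ : Finset (V d)) (hΛ : CConn Λ) (ω : Config d) (hω : plusOutside Λ ω)
    (S : Finset (V d)) (hS : CConn S)
    (hγ : frontier (cubes (↑S : Set (V d))) ∈ Gamma ω) :
    Real.exp (-(ham (Iadd (ising β) Ψ) Λ ω))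
      ≤ Real.exp (-2*(β-δ) * (csize (frontier (cubes (↑S : Set (V d)))) : ℝ)) *
        Real.exp (-(ham (Iadd (ising β) Ψ) Λ (flipOn S ω))) := by
  have hdis : ∀ e ∈ bdE S, ω e.1 ≠ ω (e.1 + ev e.2) := by
    intro e he heq
    obtain ⟨y, _, hy⟩ := hγ
    have h1 : face e.1 e.2 ⊆ frontier (cubes (↑S : Set (V d))) :=
      (face_frontier e).2 (mem_bdE.1 he)
    rw [hy] at h1
    have h2 := (face_frontier e).1 (h1.trans (connectedComponentIn_subset _ _))
    apply h2
    simp only [minusSet, Set.mem_ofPred_eq, heq]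
  have hs1 := ham_summable β hloc hti hsum Λ ω
  have hs2 := ham_summable β hloc hti hsum Λ (flipOn S ω)
  have hI : ∀ e : V d × Fin d, HasSum (fun Δ => if Δ = pr e then 2 * β else 0) (2 * β) :=
    fun e => hasSum_ite_eq (pr e) (2 * β)
  have hP : ∀ e : V d × Fin d, HasSum (fun Δ => 2 * wt Ψ e.1 Δ) (2 * anorm Ψ) := fun e => by
    have := (wt_summable hti hsum e.1).hasSum
    rw [wt_tsum hti] at this
    exact this.mul_left 2
  have hL := (hasSum_sum (s := bdE S) fun e _ => hI e).sub
    (hasSum_sum (s := bdE S) fun e _ => hP e)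
  have hR := hs1.hasSum.sub hs2.hasSum
  have hle := hasSum_le (fun Δ => ?_) hL hR
  · change _ ≤ ham (Iadd (ising β) Ψ) Λ ω - ham (Iadd (ising β) Ψ) Λ (flipOn S ω) at hle
    rw [csize_eq, ← Real.exp_add, Real.exp_le_exp]
    simp only [Finset.sum_const, nsmul_eq_mul] at hle
    have hN : (0 : ℝ) ≤ (bdE S).card := Nat.cast_nonneg _
    have := mul_le_mul_of_nonneg_left hn.le hN
    nlinarith
  · have h1 := ising_diff β Λ S Δ ω hω hdis
    have h2 := psi_diff hloc hsf hzero S Δ ω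
    rw [h1]
    rw [abs_le] at h2
    by_cases hm : (Δ ∩ Λ).Nonempty
    · simp only [hm, if_true, Iadd]
      linarith [h2.1]
    · simp only [hm, if_false]
      have : 0 ≤ ∑ e ∈ bdE S, 2 * wt Ψ e.1 Δ :=
        Finset.sum_nonneg fun e _ => mul_nonneg (by norm_num) (wt_nonneg _ _)
      linarith

end
end Ising
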